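/- Let n ≥ 3 be odd and let t be an integer with t > 1. Let j be minimal such that 0 ≤ j ≤ n and gcd(n−2j, t) = 1. Then among the degrees d_1,…,d_{n−2} of any hsop of I_n, at least ⌊(n−j)/t⌋ are divisible by 2t. -/

import Mathlib

set_option synthInstance.maxHeartbeats 1000000
noncomputable section

open MvPolynomial

/-- The binary form of degree `n` with coefficient vector `a`, as a polynomial in two
variables `X 0 = x`, `X 1 = y`. -/
def formPoly (n : ℕ) (a : Fin (n+1) → ℂ) : MvPolynomial (Fin 2) ℂ :=
  ∑ i : Fin (n+1), C (a i) * X 0 ^ (n - (i : ℕ)) * X 1 ^ (i : ℕ)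

/-- The action of `SL(2,ℂ)` on coefficient vectors of binary forms of degree `n`,
given by linear substitution of the variables `x`, `y`. -/
def sl2Act (n : ℕ) (g : Matrix.SpecialLinearGroup (Fin 2) ℂ) (a : Fin (n+1) → ℂ) :
    Fin (n+1) → ℂ := fun i =>
  coeff (Finsupp.single 0 (n - (i : ℕ)) + Finsupp.single 1 (i : ℕ))
    (bind₁ (fun j : Fin 2 => C (g.1 j 0) * X 0 + C (g.1 j 1) * X 1) (formPoly n a))

/-- The ring of invariants `I_n` of the binary form of degree `n`: the subalgebra of
`ℂ[a_0,…,a_n]` of polynomials invariant under the `SL(2,ℂ)`-action. -/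
def invariantRing (n : ℕ) : Subalgebra ℂ (MvPolynomial (Fin (n+1)) ℂ) where
  carrier := {p | ∀ g : Matrix.SpecialLinearGroup (Fin 2) ℂ, ∀ a : Fin (n+1) → ℂ,
    eval (sl2Act n g a) p = eval a p}
  mul_mem' := by
    intro p q hp hq g a
    simp only [Set.mem_setOf_eq, map_mul] at *
    rw [hp g a, hq g a]
  add_mem' := by
    intro p q hp hq g a
    simp only [Set.mem_setOf_eq, map_add] at *
    rw [hp g a, hq g a]
  algebraMap_mem' := by
    intro c g a
    simp

/-- `IsHSOP n d p` says that `p` is a homogeneous system of parameters of the invariant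
ring of the binary form of degree `n`, with degree sequence `d` : the `p k` are
homogeneous of positive degrees `d k`, algebraically independent over `ℂ`, and `I_n` is a
finitely generated module over the subalgebra they generate. -/
def IsHSOP (n : ℕ) (d : Fin (n-2) → ℕ) (p : Fin (n-2) → invariantRing n) : Prop :=
  (∀ k, 0 < d k) ∧
  (∀ k, ((p k : MvPolynomial (Fin (n+1)) ℂ)).IsHomogeneous (d k)) ∧
  AlgebraicIndependent ℂ p ∧
  Module.Finite (Algebra.adjoin ℂ (Set.range p)) (invariantRing n)

/-- The coefficient of `x ^ (|ι| - i) * y ^ i` in the product of the linear forms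
`u k * x + v k * y`. -/
def prodCoeff {ι R : Type*} [Fintype ι] [DecidableEq ι] [CommRing R] (u v : ι → R) (i : ℕ) : R :=
  ∑ s ∈ Finset.powersetCard i Finset.univ, (∏ k ∈ s, v k) * ∏ k ∈ sᶜ, u k

section prodCoeff

variable {ι R S : Type*} [Fintype ι] [DecidableEq ι] [CommRing R] [CommRing S]

lemma map_prodCoeff (φ : R →+* S) (u v : ι → R) (i : ℕ) :
    φ (prodCoeff u v i) = prodCoeff (fun k => φ (u k)) (fun k => φ (v k)) i := by
  simp [prodCoeff, map_sum, map_prod]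

lemma prod_linear_eq_sum_prodCoeff (u v : ι → R) (x y : R) :
    ∏ k, (u k * x + v k * y) =
      ∑ i ∈ Finset.range (Fintype.card ι + 1),
        prodCoeff u v i * x ^ (Fintype.card ι - i) * y ^ i := by
  have h : ∏ k, (u k * x + v k * y) = ∏ k, (v k * y + u k * x) := by
    simp only [add_comm]
  rw [h, Finset.prod_add, Finset.sum_powerset, Finset.card_univ]
  refine Finset.sum_congr rfl fun i _ => ?_
  rw [prodCoeff, Finset.sum_mul, Finset.sum_mul]
  refine Finset.sum_congr rfl fun s hs => ?_
  have hc := (Finset.mem_powersetCard.1 hs).2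
  rw [Finset.prod_mul_distrib, Finset.prod_mul_distrib, Finset.prod_const, Finset.prod_const,
    ← Finset.compl_eq_univ_sdiff, Finset.card_compl, hc]
  ring

lemma prodCoeff_zero (u v : ι → R) : prodCoeff u v 0 = ∏ k, u k := by
  simp [prodCoeff]

lemma prodCoeff_comp_equiv (e : Equiv.Perm ι) (u v : ι → R) (i : ℕ) :
    prodCoeff (u ∘ e) (v ∘ e) i = prodCoeff u v i := by
  rw [prodCoeff, prodCoeff]
  refine Finset.sum_equiv (Equiv.finsetCongr e) (fun s => by simp [Finset.mem_powersetCard])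
    fun s _ => ?_
  have hcompl : (s.map e.toEmbedding)ᶜ = sᶜ.map e.toEmbedding := by
    ext k
    simp
  simp [Equiv.finsetCongr, hcompl]

lemma prodCoeff_smul (s u v : ι → R) (i : ℕ) :
    prodCoeff (s * u) (s * v) i = (∏ k, s k) * prodCoeff u v i := by
  rw [prodCoeff, prodCoeff, Finset.mul_sum]
  refine Finset.sum_congr rfl fun t _ => ?_
  simp only [Pi.mul_apply, Finset.prod_mul_distrib]
  rw [← Finset.prod_mul_prod_compl t s]
  ring

end prodCoeff

lemma coeff_sum_C_mul_X_pow_mul_X_pow {σ : Type*} {x y : σ} (hxy : x ≠ y) (n : ℕ)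
    (a : Fin (n+1) → ℂ) (i : Fin (n+1)) :
    coeff (Finsupp.single x (n - (i : ℕ)) + Finsupp.single y (i : ℕ))
      (∑ i : Fin (n+1), C (a i) * X x ^ (n - (i : ℕ)) * X y ^ (i : ℕ)) = a i := by
  classical
  rw [coeff_sum, Finset.sum_eq_single i]
  · rw [mul_assoc, coeff_C_mul, X_pow_eq_monomial, X_pow_eq_monomial, monomial_mul, coeff_monomial]
    simp
  · intro k _ hk
    rw [mul_assoc, coeff_C_mul, X_pow_eq_monomial, X_pow_eq_monomial, monomial_mul, coeff_monomial,
      if_neg, mul_zero]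
    intro h
    apply hk
    have := DFunLike.congr_fun h y
    simpa [Fin.ext_iff, hxy] using this
  · simp

section product_of_linear_forms

variable {ι : Type*} [Fintype ι] [DecidableEq ι]

lemma formPoly_prodCoeff (u v : ι → ℂ) :
    formPoly (Fintype.card ι) (fun i => prodCoeff u v i) = ∏ k, (C (u k) * X 0 + C (v k) * X 1) := by
  rw [prod_linear_eq_sum_prodCoeff, formPoly, Finset.sum_range]
  simp [map_prodCoeff]

lemma sl2Act_prodCoeff (g : Matrix.SpecialLinearGroup (Fin 2) ℂ) (u v : ι → ℂ) :
    sl2Act (Fintype.card ι) g (fun i => prodCoeff u v i) =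
      fun i : Fin (Fintype.card ι + 1) => prodCoeff (fun k => u k * g.1 0 0 + v k * g.1 1 0)
        (fun k => u k * g.1 0 1 + v k * g.1 1 1) i := by
  funext i
  rw [sl2Act, formPoly_prodCoeff, map_prod]
  refine Eq.trans (congrArg _ ?_) (coeff_sum_C_mul_X_pow_mul_X_pow zero_ne_one _
    (fun i : Fin (Fintype.card ι + 1) => prodCoeff (fun k => u k * g.1 0 0 + v k * g.1 1 0)
        (fun k => u k * g.1 0 1 + v k * g.1 1 1) i) i)
  have h := prod_linear_eq_sum_prodCoeff (R := MvPolynomial ℕ ℂ)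
    (fun k => C (u k * g.1 0 0 + v k * g.1 1 0)) (fun k => C (u k * g.1 0 1 + v k * g.1 1 1))
    (X 0) (X 1)
  rw [Finset.sum_range] at h
  simp only [← map_prodCoeff C] at h
  rw [← h]
  apply Finset.prod_congr rfl
  intro k _
  simp only [map_add, map_mul, bind₁_C_right, bind₁_X_right]
  ring

end product_of_linear_forms

lemma exists_prod_linear_eq (n : ℕ) (q : Polynomial ℂ) (hq : q.natDegree ≤ n) :
    ∃ (c : ℂ) (u v : Fin n → ℂ), q = Polynomial.C c *
      ∏ k, (Polynomial.C (u k) + Polynomial.C (v k) * Polynomial.X) := by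
  induction n generalizing q with
  | zero => exact ⟨q.coeff 0, 0, 0, by simpa using Polynomial.eq_C_of_natDegree_le_zero hq⟩
  | succ n ih =>
    by_cases hd : q.natDegree ≤ n
    · obtain ⟨c, u, v, h⟩ := ih q hd
      refine ⟨c, Fin.cons 1 u, Fin.cons 0 v, ?_⟩
      rw [Fin.prod_univ_succ]
      simpa using h
    · have hpos : q.degree ≠ 0 := fun h => hd (by simp [Polynomial.natDegree_eq_zero_iff_degree_le_zero.2 h.le])
      obtain ⟨r, hr⟩ := IsAlgClosed.exists_root q hpos
      obtain ⟨q', rfl⟩ := Polynomial.dvd_iff_isRoot.2 hr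
      obtain ⟨c, u, v, h⟩ := ih q' (by
        by_cases h0 : q' = 0
        · simp [h0]
        · rw [Polynomial.natDegree_mul (Polynomial.X_sub_C_ne_zero r) h0,
            Polynomial.natDegree_X_sub_C] at hq
          omega)
      refine ⟨c, Fin.cons (-r) u, Fin.cons 1 v, ?_⟩
      rw [Fin.prod_univ_succ, h]
      simp only [Fin.cons_zero, Fin.cons_succ, map_neg, map_one]
      ring

/-- Every binary form over `ℂ` of positive degree is a product of linear forms. -/
lemma exists_prodCoeff_eq {ι : Type*} [Fintype ι] [DecidableEq ι] [Nonempty ι]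
    (a : Fin (Fintype.card ι + 1) → ℂ) :
    ∃ u v : ι → ℂ, (fun i : Fin (Fintype.card ι + 1) => prodCoeff u v i) = a := by
  set q : Polynomial ℂ := ∑ i : Fin (Fintype.card ι + 1), Polynomial.C (a i) * Polynomial.X ^ (i : ℕ)
    with hqdef
  have hcoeff : ∀ i : Fin (Fintype.card ι + 1), q.coeff i = a i := by
    intro i
    rw [hqdef, Polynomial.finsetSum_coeff, Finset.sum_eq_single i]
    · simp
    · intro k _ hk
      rw [Polynomial.coeff_C_mul_X_pow, if_neg fun h => hk (Fin.ext h.symm)]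
    · simp
  have hdeg : q.natDegree ≤ Fintype.card ι := by
    refine Polynomial.natDegree_sum_le_of_forall_le _ _ fun i _ => ?_
    exact (Polynomial.natDegree_C_mul_X_pow_le _ _).trans (by omega)
  obtain ⟨c, u, v, h⟩ := exists_prod_linear_eq _ q hdeg
  let e := Fintype.equivFin ι
  let k₀ : ι := Classical.arbitrary ι
  let s : ι → ℂ := Pi.mulSingle k₀ c
  have hs : ∏ k, s k = c := by simp [s]
  refine ⟨s * (u ∘ e), s * (v ∘ e), funext fun i => ?_⟩
  rw [prodCoeff_smul, hs, ← hcoeff, h, Polynomial.coeff_C_mul]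
  congr 1
  rw [← Equiv.prod_comp e]
  have := prod_linear_eq_sum_prodCoeff (fun k => Polynomial.C (u (e k)))
    (fun k => Polynomial.C (v (e k))) 1 Polynomial.X
  simp only [mul_one, one_pow] at this
  rw [this, Polynomial.finsetSum_coeff, Finset.sum_eq_single (i : ℕ)]
  · rw [← map_prodCoeff Polynomial.C]
    simp [Function.comp_def]
  · intro k _ hk
    rw [← map_prodCoeff Polynomial.C, Polynomial.coeff_C_mul_X_pow, if_neg hk.symm]
  · intro hi
    exact absurd (Finset.mem_range.2 i.2) hi

lemma MvPolynomial.eq_of_eval_eq_of_eval_ne_zero {σ : Type*} {p q r : MvPolynomial σ ℂ}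
    (hr : r ≠ 0) (h : ∀ x, eval x r ≠ 0 → eval x p = eval x q) : p = q := by
  have hz : (p - q) * r = 0 := by
    refine MvPolynomial.funext fun x => ?_
    by_cases hx : eval x r = 0
    · simp [hx]
    · simp [h x hx]
  exact sub_eq_zero.1 ((mul_eq_zero.1 hz).resolve_right hr)

lemma MvPolynomial.X_zero_dvd_of_eval_eq_zero {n : ℕ} {N : MvPolynomial (Fin (n+1)) ℂ}
    (h : ∀ a : Fin (n+1) → ℂ, a 0 = 0 → eval a N = 0) : X 0 ∣ N := by
  have h0 : (finSuccEquiv ℂ n N).coeff 0 = 0 := by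
    refine MvPolynomial.funext fun s => ?_
    have := h (Fin.cons 0 s) rfl
    rw [eval_eq_eval_mv_eval', ← Polynomial.coeff_zero_eq_eval_zero, Polynomial.coeff_map] at this
    simpa using this
  obtain ⟨c, hc⟩ := Polynomial.X_dvd_iff.2 h0
  refine ⟨(finSuccEquiv ℂ n).symm c, (finSuccEquiv ℂ n).injective ?_⟩
  rw [hc, map_mul, finSuccEquiv_X_zero, AlgEquiv.apply_symm_apply]

lemma MvPolynomial.exists_eval_eq_pow_mul_eval_div {n : ℕ} (H : MvPolynomial (Fin n) ℂ) :
    ∃ (k : ℕ) (N : MvPolynomial (Fin (n+1)) ℂ), ∀ a : Fin (n+1) → ℂ, a 0 ≠ 0 →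
      eval a N = a 0 ^ k * eval (fun i : Fin n => a i.succ / a 0) H := by
  induction H using MvPolynomial.induction_on with
  | C c => exact ⟨0, C c, by simp⟩
  | add p q hp hq =>
    obtain ⟨k, N, hN⟩ := hp
    obtain ⟨l, M, hM⟩ := hq
    refine ⟨k + l, X 0 ^ l * N + X 0 ^ k * M, fun a ha => ?_⟩
    simp only [map_add, map_mul, map_pow, eval_X, hN a ha, hM a ha]
    ring
  | mul_X p i hp =>
    obtain ⟨k, N, hN⟩ := hp
    refine ⟨k + 1, N * X i.succ, fun a ha => ?_⟩
    simp only [map_mul, eval_X, hN a ha]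
    field_simp
    ring

lemma MvPolynomial.eval_eq_aeval {σ : Type*} (x : σ → ℂ) (p : MvPolynomial σ ℂ) :
    eval x p = aeval x p := by
  rw [← coe_aeval_eq_eval]
  rfl

lemma prod_X_inl_ne_zero {ι : Type*} [Fintype ι] :
    (∏ k : ι, X (Sum.inl k) : MvPolynomial (ι ⊕ ι) ℂ) ≠ 0 :=
  Finset.prod_ne_zero_iff.2 fun _ _ => X_ne_zero _

section descent

variable {ι : Type*} [Fintype ι] [DecidableEq ι]

lemma eval_esymm_eq_prodCoeff (w : ι → ℂ) (i : ℕ) :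
    eval w (esymm ι ℂ i) = prodCoeff 1 w i := by
  simp [esymm, prodCoeff]

/-- Pulling a polynomial in the coefficients of a form back to the linear factors. -/
def pullback (ι : Type*) [Fintype ι] [DecidableEq ι] :
    MvPolynomial (Fin (Fintype.card ι + 1)) ℂ →ₐ[ℂ] MvPolynomial (ι ⊕ ι) ℂ :=
  aeval fun i => prodCoeff (fun k => X (Sum.inl k)) (fun k => X (Sum.inr k)) (i : ℕ)

lemma aeval_pullback {R : Type*} [CommRing R] [Algebra ℂ R] (u v : ι → R)
    (I : MvPolynomial (Fin (Fintype.card ι + 1)) ℂ) :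
    aeval (Sum.elim u v) (pullback ι I) =
      aeval (fun i : Fin (Fintype.card ι + 1) => prodCoeff u v (i : ℕ)) I := by
  rw [pullback, comp_aeval_apply]
  congr 2
  funext i
  rw [← AlgHom.coe_toRingHom, map_prodCoeff]
  simp

lemma eval_pullback (u v : ι → ℂ) (I : MvPolynomial (Fin (Fintype.card ι + 1)) ℂ) :
    eval (Sum.elim u v) (pullback ι I) =
      eval (fun i : Fin (Fintype.card ι + 1) => prodCoeff u v (i : ℕ)) I := by
  simpa only [eval_eq_aeval] using aeval_pullback u v I

/-- `Q` is homogeneous of degree `D` in each of the linear forms `u k * x + v k * y`. -/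
def IsMultihomogeneous (Q : MvPolynomial (ι ⊕ ι) ℂ) (D : ℕ) : Prop :=
  ∀ s u v : ι → ℂ, eval (Sum.elim (s * u) (s * v)) Q = (∏ k, s k) ^ D * eval (Sum.elim u v) Q

/-- `Q` is invariant under permutations of the linear forms `u k * x + v k * y`. -/
def IsPermInvariant (Q : MvPolynomial (ι ⊕ ι) ℂ) : Prop :=
  ∀ (e : Equiv.Perm ι) (u v : ι → ℂ), eval (Sum.elim (u ∘ e) (v ∘ e)) Q = eval (Sum.elim u v) Q

lemma pullback_eq_of_pullback_eq_prod_pow_mul [Nonempty ι] {Q : MvPolynomial (ι ⊕ ι) ℂ} (k : ℕ)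
    (N : MvPolynomial (Fin (Fintype.card ι + 1)) ℂ)
    (hN : pullback ι N = (∏ k, X (Sum.inl k)) ^ k * Q) : ∃ I, pullback ι I = Q := by
  induction k generalizing N with
  | zero => exact ⟨N, by simpa using hN⟩
  | succ k ih =>
    obtain ⟨M, rfl⟩ : X 0 ∣ N := by
      refine X_zero_dvd_of_eval_eq_zero fun a ha => ?_
      obtain ⟨u, v, rfl⟩ := exists_prodCoeff_eq a
      rw [← eval_pullback, hN, pow_succ]
      simp only [Fin.val_zero, prodCoeff_zero] at ha
      simp [map_prod, ha]
    refine ih M (mul_left_cancel₀ (prod_X_inl_ne_zero (ι := ι)) ?_)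
    have h0 : pullback ι (X 0) = ∏ k, X (Sum.inl k) := by
      simp [pullback, prodCoeff_zero]
    rw [← h0, ← map_mul, hN, h0, pow_succ]
    ring

/-- A symmetric multihomogeneous polynomial in the linear factors of a form is a polynomial in
the coefficients of the form. -/
lemma exists_pullback_eq [Nonempty ι] {Q : MvPolynomial (ι ⊕ ι) ℂ} {D : ℕ}
    (hD : IsMultihomogeneous Q D) (hQ : IsPermInvariant Q) : ∃ I, pullback ι I = Q := by
  set S : MvPolynomial ι ℂ := aeval (Sum.elim (fun _ => 1) X) Q with hS
  have hSeval : ∀ w : ι → ℂ, eval w S = eval (Sum.elim 1 w) Q := by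
    intro w
    rw [hS, eval_eq_aeval, eval_eq_aeval, comp_aeval_apply]
    congr 2
    funext i
    rcases i with i | i <;> simp
  have hsymm : S.IsSymmetric := by
    intro e
    refine MvPolynomial.funext fun w => ?_
    rw [eval_rename, hSeval, hSeval]
    exact hQ e 1 w
  obtain ⟨H, hH⟩ := esymmAlgHom_surjective (σ := ι) (R := ℂ) (n := Fintype.card ι) le_rfl ⟨S, hsymm⟩
  have hH' : ∀ w : ι → ℂ, eval w S =
      eval (fun i : Fin (Fintype.card ι) => prodCoeff 1 w ((i : ℕ) + 1)) H := by
    intro w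
    have h1 : aeval (fun i : Fin (Fintype.card ι) => esymm ι ℂ ((i : ℕ) + 1)) H = S := by
      rw [← esymmAlgHom_apply, hH]
    simp only [← h1, ← eval_esymm_eq_prodCoeff, eval_eq_aeval, comp_aeval_apply]
  obtain ⟨k, N, hN⟩ := exists_eval_eq_pow_mul_eval_div H
  refine pullback_eq_of_pullback_eq_prod_pow_mul k (X 0 ^ D * N) ?_
  refine eq_of_eval_eq_of_eval_ne_zero (prod_X_inl_ne_zero (ι := ι)) fun x hx => ?_
  obtain ⟨u, v, rfl⟩ : ∃ u v : ι → ℂ, x = Sum.elim u v := ⟨_, _, (Sum.elim_comp_inl_inr x).symm⟩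
  simp only [map_prod, eval_X, Sum.elim_inl] at hx
  have hu : ∀ k, u k ≠ 0 := fun k => Finset.prod_ne_zero_iff.1 hx k (Finset.mem_univ k)
  have huv : Sum.elim u v = Sum.elim (u * 1) (u * (v / u)) := by
    congr 1
    · simp
    · funext k
      simp [mul_div_cancel₀ _ (hu k)]
  rw [eval_pullback, map_mul, hN _ (by simpa [prodCoeff_zero] using hx)]
  simp only [map_mul, map_pow, map_prod, eval_X, Sum.elim_inl, Fin.val_zero, prodCoeff_zero,
    Fin.val_succ]
  have hdiv : ∀ i : ℕ, prodCoeff u v i / ∏ k, u k = prodCoeff 1 (v / u) i := by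
    intro i
    have h1 : u = u * 1 := by simp
    have h2 : v = u * (v / u) := by
      funext k
      simp [mul_div_cancel₀ _ (hu k)]
    have h3 : prodCoeff u v i = (∏ k, u k) * prodCoeff 1 (v / u) i := by
      rw [← prodCoeff_smul, ← h1, ← h2]
    rw [h3, mul_div_cancel_left₀ _ hx]
  simp only [hdiv]
  rw [← hH', hSeval]
  conv_rhs => rw [huv, hD]
  ring

end descent

lemma eval_rename_sumMap {ι : Type*} (σ : Equiv.Perm ι) (Q : MvPolynomial (ι ⊕ ι) ℂ) (u v : ι → ℂ) :
    eval (Sum.elim u v) (rename (Sum.map σ σ) Q) = eval (Sum.elim (u ∘ σ) (v ∘ σ)) Q := by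
  rw [eval_rename, Sum.elim_comp_map]

section invariants

variable {ι : Type*} [Fintype ι] [DecidableEq ι]

/-- `Q` is invariant under the simultaneous action of `SL(2,ℂ)` on the linear forms
`u k * x + v k * y`. -/
def IsSLInvariant (Q : MvPolynomial (ι ⊕ ι) ℂ) : Prop :=
  ∀ (g : Matrix.SpecialLinearGroup (Fin 2) ℂ) (u v : ι → ℂ),
    eval (Sum.elim (fun k => u k * g.1 0 0 + v k * g.1 1 0)
      (fun k => u k * g.1 0 1 + v k * g.1 1 1)) Q = eval (Sum.elim u v) Q

lemma exists_mem_invariantRing_pullback_eq [Nonempty ι] {Q : MvPolynomial (ι ⊕ ι) ℂ} {D : ℕ}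
    (hD : IsMultihomogeneous Q D) (hQ : IsPermInvariant Q) (hg : IsSLInvariant Q) :
    ∃ I : invariantRing (Fintype.card ι), pullback ι I = Q := by
  obtain ⟨I, rfl⟩ := exists_pullback_eq hD hQ
  refine ⟨⟨I, fun g a => ?_⟩, rfl⟩
  obtain ⟨u, v, rfl⟩ := exists_prodCoeff_eq a
  rw [sl2Act_prodCoeff, ← eval_pullback, ← eval_pullback]
  exact hg g u v

/-- The elementary symmetric functions of the permuted copies of `Q`. -/
def permEsymm (Q : MvPolynomial (ι ⊕ ι) ℂ) (k : ℕ) : MvPolynomial (ι ⊕ ι) ℂ :=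
  ∑ T ∈ Finset.powersetCard k (Finset.univ : Finset (Equiv.Perm ι)),
    ∏ σ ∈ T, rename (Sum.map σ σ) Q

lemma eval_permEsymm (Q : MvPolynomial (ι ⊕ ι) ℂ) (k : ℕ) (u v : ι → ℂ) :
    eval (Sum.elim u v) (permEsymm Q k) =
      ∑ T ∈ Finset.powersetCard k (Finset.univ : Finset (Equiv.Perm ι)),
        ∏ σ ∈ T, eval (Sum.elim (u ∘ σ) (v ∘ σ)) Q := by
  simp only [permEsymm, map_sum, map_prod, eval_rename_sumMap]

lemma IsMultihomogeneous.permEsymm {Q : MvPolynomial (ι ⊕ ι) ℂ} {D : ℕ}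
    (hD : IsMultihomogeneous Q D) (k : ℕ) : IsMultihomogeneous (permEsymm Q k) (D * k) := by
  intro s u v
  rw [eval_permEsymm, eval_permEsymm, Finset.mul_sum]
  refine Finset.sum_congr rfl fun T hT => ?_
  have hσ : ∀ σ : Equiv.Perm ι, eval (Sum.elim ((s * u) ∘ σ) ((s * v) ∘ σ)) Q =
      (∏ k, s k) ^ D * eval (Sum.elim (u ∘ σ) (v ∘ σ)) Q := by
    intro σ
    rw [← Equiv.prod_comp σ s]
    exact hD (s ∘ σ) (u ∘ σ) (v ∘ σ)
  rw [Finset.prod_congr rfl fun σ _ => hσ σ, Finset.prod_mul_distrib, Finset.prod_const,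
    (Finset.mem_powersetCard.1 hT).2, pow_mul]

lemma IsSLInvariant.permEsymm {Q : MvPolynomial (ι ⊕ ι) ℂ} (hg : IsSLInvariant Q) (k : ℕ) :
    IsSLInvariant (permEsymm Q k) := by
  intro g u v
  rw [eval_permEsymm, eval_permEsymm]
  exact Finset.sum_congr rfl fun T _ => Finset.prod_congr rfl fun σ _ => hg g (u ∘ σ) (v ∘ σ)

lemma isPermInvariant_permEsymm (Q : MvPolynomial (ι ⊕ ι) ℂ) (k : ℕ) :
    IsPermInvariant (permEsymm Q k) := by
  intro e u v
  rw [eval_permEsymm, eval_permEsymm]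
  refine Finset.sum_equiv (Equiv.finsetCongr (Equiv.mulLeft e))
    (fun s => by simp [Finset.mem_powersetCard]) fun s _ => ?_
  simp only [Equiv.finsetCongr_apply, Finset.prod_map]
  rfl

/-- An `SL(2,ℂ)`-invariant multihomogeneous polynomial in the linear factors of a form is
integral over the ring of invariants. -/
lemma isIntegralElem_pullback [Nonempty ι] {Q : MvPolynomial (ι ⊕ ι) ℂ} {D : ℕ}
    (hD : IsMultihomogeneous Q D) (hg : IsSLInvariant Q) :
    ((pullback ι).toRingHom.comp
      (invariantRing (Fintype.card ι)).val.toRingHom).IsIntegralElem Q := by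
  set f := (pullback ι).toRingHom.comp (invariantRing (Fintype.card ι)).val.toRingHom with hf
  set m : Multiset (MvPolynomial (ι ⊕ ι) ℂ) :=
    (Finset.univ : Finset (Equiv.Perm ι)).val.map fun σ : Equiv.Perm ι => rename (Sum.map σ σ) Q with hm
  set q := (m.map fun x => Polynomial.X - Polynomial.C x).prod with hq
  have hesymm : ∀ k, m.esymm k = permEsymm Q k := fun k => by
    rw [hm, Finset.esymm_map_val]
    rfl
  have hdeg : q.natDegree = m.card := Polynomial.natDegree_multiset_prod_X_sub_C_eq_card m
  have hlift : q ∈ Polynomial.lifts f := by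
    rw [Polynomial.lifts_iff_coeff_lifts]
    intro k
    by_cases hk : k ≤ m.card
    · rw [hq, Multiset.prod_X_sub_C_coeff m hk, hesymm]
      obtain ⟨I, hI⟩ := exists_mem_invariantRing_pullback_eq (hD.permEsymm (m.card - k))
        (isPermInvariant_permEsymm Q _) (hg.permEsymm _)
      refine ⟨(-1) ^ (m.card - k) * I, ?_⟩
      rw [map_mul, map_pow, map_neg, map_one, ← hI]
      rfl
    · rw [Polynomial.coeff_eq_zero_of_natDegree_lt (by omega)]
      exact ⟨0, map_zero f⟩
  obtain ⟨p, hp, -, hmonic⟩ := Polynomial.lifts_and_natDegree_eq_and_monic hlift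
    (Polynomial.monic_multiset_prod_of_monic _ _ fun x _ => Polynomial.monic_X_sub_C x)
  refine ⟨p, hmonic, ?_⟩
  rw [← Polynomial.eval_map, hp, hq, Polynomial.eval_multiset_prod]
  refine Multiset.prod_eq_zero ?_
  simp only [hm, Multiset.map_map, Multiset.mem_map, Finset.mem_val, Finset.mem_univ, true_and]
  exact ⟨1, by simp⟩

end invariants

lemma isIntegral_of_isIntegralElem_of_map_le {A R : Type*} [CommRing A] [CommRing R] [Algebra ℂ A]
    [Algebra ℂ R] {B : Subalgebra ℂ A} [Algebra.IsIntegral B A] (f : A →ₐ[ℂ] R)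
    {G : Subalgebra ℂ R} (hG : B.map f ≤ G) {x : R} (hx : f.toRingHom.IsIntegralElem x) :
    IsIntegral G x := by
  let := f.toRingHom.toAlgebra
  have hA : IsIntegral A x := hx
  obtain ⟨q, hq, hqx⟩ : IsIntegral B x := isIntegral_trans x hA
  let h : B →+* G := ((f.comp B.val).codRestrict G fun b => hG ⟨b, b.2, rfl⟩).toRingHom
  refine ⟨q.map h, hq.map h, ?_⟩
  rw [Polynomial.eval₂_map]
  exact hqx

/-- If all members of a hsop outside of `K` vanish at an `R`-valued product of linear forms,
then the values of the invariants of the linear factors are integral over the values of the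
members in `K`. -/
lemma IsHSOP.isIntegral_aeval {ι : Type*} [Fintype ι] [DecidableEq ι] [Nonempty ι]
    {d : Fin (Fintype.card ι - 2) → ℕ}
    {p : Fin (Fintype.card ι - 2) → invariantRing (Fintype.card ι)}
    (hp : IsHSOP (Fintype.card ι) d p) {R : Type*} [CommRing R] [Algebra ℂ R] (u v : ι → R)
    (K : Finset (Fin (Fintype.card ι - 2)))
    (hK : ∀ k ∉ K, aeval (fun i : Fin (Fintype.card ι + 1) => prodCoeff u v (i : ℕ)) (p k).1 = 0)
    {Q : MvPolynomial (ι ⊕ ι) ℂ} {D : ℕ} (hD : IsMultihomogeneous Q D) (hg : IsSLInvariant Q) :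
    IsIntegral (Algebra.adjoin ℂ ((fun k =>
      aeval (fun i : Fin (Fintype.card ι + 1) => prodCoeff u v (i : ℕ)) (p k).1) '' (K : Set _)))
      (aeval (Sum.elim u v) Q) := by
  have hfin := hp.2.2.2
  set f : invariantRing (Fintype.card ι) →ₐ[ℂ] R :=
    (aeval fun i : Fin (Fintype.card ι + 1) => prodCoeff u v (i : ℕ)).comp
      (invariantRing (Fintype.card ι)).val with hf
  have hBint : Algebra.IsIntegral (Algebra.adjoin ℂ (Set.range p))
    (invariantRing (Fintype.card ι)) := Algebra.IsIntegral.of_finite _ _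
  refine isIntegral_of_isIntegralElem_of_map_le (B := Algebra.adjoin ℂ (Set.range p)) f ?_ ?_
  · rw [AlgHom.map_adjoin, Algebra.adjoin_le_iff]
    rintro _ ⟨_, ⟨k, rfl⟩, rfl⟩
    by_cases hk : k ∈ K
    · exact Algebra.subset_adjoin ⟨k, hk, rfl⟩
    · have h0 : f (p k) = 0 := hK k hk
      rw [h0]
      exact Subalgebra.zero_mem _
  · obtain ⟨q, hq, hq0⟩ := isIntegralElem_pullback hD hg
    refine ⟨q, hq, ?_⟩
    have hcomp : f.toRingHom = (aeval (Sum.elim u v)).toRingHom.comp ((pullback ι).toRingHom.comp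
        (invariantRing (Fintype.card ι)).val.toRingHom) := by
      ext I
      exact (aeval_pullback u v I.1).symm
    have := congrArg (aeval (Sum.elim u v)).toRingHom hq0
    rw [Polynomial.hom_eval₂, ← hcomp, map_zero] at this
    exact this

lemma exists_eq_add_single_add_single {ι : Type*} [DecidableEq ι] {w : ι × ι → ℕ} {e f : ι × ι} (hef : e ≠ f)
    (he : w e ≠ 0) (hf : w f ≠ 0) : ∃ w₀ : ι × ι → ℕ, w = w₀ + Pi.single e 1 + Pi.single f 1 := by
  refine ⟨w - (Pi.single e 1 + Pi.single f 1), ?_⟩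
  rw [add_assoc, tsub_add_cancel_of_le]
  intro x
  simp only [Pi.add_apply, Pi.single_apply]
  by_cases hxe : x = e
  · subst hxe
    simp [hef]
    omega
  · by_cases hxf : x = f
    · subst hxf
      simp [hxe]
      omega
    · simp [hxe, hxf]

section brackets

variable {ι : Type*} [Fintype ι]

/-- The product of the brackets `u a * v b - u b * v a`, with multiplicities `w (a, b)`. -/
def bracketProd {R : Type*} [CommRing R] (u v : ι → R) (w : ι × ι → ℕ) : R :=
  ∏ e, (u e.1 * v e.2 - u e.2 * v e.1) ^ w e

/-- The generic bracket monomial with multiplicities `w`. -/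
def bracketMonomial (w : ι × ι → ℕ) : MvPolynomial (ι ⊕ ι) ℂ :=
  bracketProd (fun k => X (Sum.inl k)) (fun k => X (Sum.inr k)) w

/-- Every index occurs `D` times in the multigraph with edge multiplicities `w`. -/
def IsRegularWeight (w : ι × ι → ℕ) (D : ℕ) : Prop :=
  ∀ k, ∑ l, w (k, l) + ∑ l, w (l, k) = D

lemma map_bracketProd {R S : Type*} [CommRing R] [CommRing S] (φ : R →+* S) (u v : ι → R)
    (w : ι × ι → ℕ) :
    φ (bracketProd u v w) = bracketProd (fun k => φ (u k)) (fun k => φ (v k)) w := by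
  simp [bracketProd]

lemma aeval_bracketMonomial {R : Type*} [CommRing R] [Algebra ℂ R] (u v : ι → R)
    (w : ι × ι → ℕ) : aeval (Sum.elim u v) (bracketMonomial w) = bracketProd u v w := by
  simp [bracketMonomial, bracketProd]

lemma bracketProd_add {R : Type*} [CommRing R] (u v : ι → R) (w w' : ι × ι → ℕ) :
    bracketProd u v (w + w') = bracketProd u v w * bracketProd u v w' := by
  simp [bracketProd, pow_add, Finset.prod_mul_distrib]

lemma bracketProd_single [DecidableEq ι] {R : Type*} [CommRing R] (u v : ι → R) (e : ι × ι) :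
    bracketProd u v (Pi.single e 1) = u e.1 * v e.2 - u e.2 * v e.1 := by
  rw [bracketProd, Finset.prod_eq_single e]
  · simp
  · intro f _ hf
    simp [hf]
  · simp

lemma IsRegularWeight.prod_pow {w : ι × ι → ℕ} {D : ℕ} (hw : IsRegularWeight w D)
    {R : Type*} [CommRing R] (s : ι → R) : ∏ e, (s e.1 * s e.2) ^ w e = (∏ k, s k) ^ D := by
  simp only [mul_pow, Finset.prod_mul_distrib]
  rw [Fintype.prod_prod_type, Fintype.prod_prod_type_right, ← Finset.prod_mul_distrib,
    ← Finset.prod_pow]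
  refine Finset.prod_congr rfl fun k _ => ?_
  dsimp only
  rw [Finset.prod_pow_eq_pow_sum, Finset.prod_pow_eq_pow_sum, ← pow_add, hw k]

lemma IsRegularWeight.bracketProd_mul {w : ι × ι → ℕ} {D : ℕ} (hw : IsRegularWeight w D)
    {R : Type*} [CommRing R] (s u v : ι → R) :
    bracketProd (s * u) (s * v) w = (∏ k, s k) ^ D * bracketProd u v w := by
  rw [← hw.prod_pow, bracketProd, bracketProd, ← Finset.prod_mul_distrib]
  refine Finset.prod_congr rfl fun e _ => ?_
  rw [← mul_pow]
  simp only [Pi.mul_apply]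
  ring

lemma IsRegularWeight.isMultihomogeneous [DecidableEq ι] {w : ι × ι → ℕ} {D : ℕ}
    (hw : IsRegularWeight w D) : IsMultihomogeneous (bracketMonomial w) D := by
  intro s u v
  simp only [eval_eq_aeval, aeval_bracketMonomial, hw.bracketProd_mul]

lemma isSLInvariant_bracketMonomial [DecidableEq ι] (w : ι × ι → ℕ) :
    IsSLInvariant (bracketMonomial w) := by
  intro g u v
  simp only [eval_eq_aeval, aeval_bracketMonomial, bracketProd]
  refine Finset.prod_congr rfl fun e _ => ?_
  have hg := g.2
  rw [Matrix.det_fin_two] at hg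
  congr 1
  linear_combination (u e.1 * v e.2 - u e.2 * v e.1) * hg

lemma sum_single_add_sum_single [DecidableEq ι] (e : ι × ι) (k : ι) :
    ∑ l, (Pi.single e 1 : ι × ι → ℕ) (k, l) + ∑ l, (Pi.single e 1 : ι × ι → ℕ) (l, k) =
      (if e.1 = k then 1 else 0) + (if e.2 = k then 1 else 0) := by
  obtain ⟨a, b⟩ := e
  simp only [Pi.single_apply, Prod.mk.injEq]
  congr 1
  · by_cases h : a = k
    · simp [h]
    · simp [h, Ne.symm h]
  · by_cases h : b = k
    · simp [h]
    · simp [h, Ne.symm h]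

lemma isRegularWeight_add_iff [DecidableEq ι] {w₀ : ι × ι → ℕ} {D : ℕ} (a b c d : ι) :
    IsRegularWeight (w₀ + Pi.single (a, b) 1 + Pi.single (c, d) 1) D ↔
      ∀ k, ∑ l, w₀ (k, l) + ∑ l, w₀ (l, k) + ((if a = k then 1 else 0) +
        (if b = k then 1 else 0) + (if c = k then 1 else 0) + (if d = k then 1 else 0)) = D := by
  refine forall_congr' fun k => ?_
  simp only [Pi.add_apply, Finset.sum_add_distrib]
  have h₁ := sum_single_add_sum_single (a, b) k
  have h₂ := sum_single_add_sum_single (c, d) k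
  simp only at h₁ h₂
  rw [← Nat.add_left_inj (n := 0)]
  constructor <;> intro h <;> omega

lemma IsRegularWeight.swap [DecidableEq ι] {w₀ : ι × ι → ℕ} {D : ℕ} {a b c d : ι}
    (h : IsRegularWeight (w₀ + Pi.single (a, b) 1 + Pi.single (c, d) 1) D) :
    IsRegularWeight (w₀ + Pi.single (a, c) 1 + Pi.single (b, d) 1) D := by
  rw [isRegularWeight_add_iff] at h ⊢
  intro k
  rw [← h k]
  ring

end brackets

section baseWeight

variable {Z C : Type*} [Fintype Z] [Fintype C] [DecidableEq C]

/-- A regular multigraph on `Z ⊕ C` without edges inside `Z`. -/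
def baseWeight (Z C : Type*) [Fintype Z] [Fintype C] [DecidableEq C] : (Z ⊕ C) × (Z ⊕ C) → ℕ
  | (Sum.inl _, Sum.inr _) => 2 * (Fintype.card C - 1)
  | (Sum.inr c, Sum.inr c') => if c = c' then 0 else Fintype.card C - Fintype.card Z
  | (_, Sum.inl _) => 0

lemma isRegularWeight_baseWeight (h : Fintype.card Z ≤ Fintype.card C) :
    IsRegularWeight (baseWeight Z C) (2 * Fintype.card C * (Fintype.card C - 1)) := by
  rintro (z | c)
  · simp only [Fintype.sum_sum_type, baseWeight]
    simp
    ring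
  · simp only [Fintype.sum_sum_type, baseWeight]
    have h₁ : ∀ x : ℕ, ∑ c', (if c = c' then 0 else x) = (Fintype.card C - 1) * x := by
      intro x
      rw [← Finset.add_sum_erase _ _ (Finset.mem_univ c), Finset.sum_congr rfl
        (g := fun _ => x) fun c' hc' => by simp [(Finset.ne_of_mem_erase hc').symm]]
      simp
    have h₂ : ∀ x : ℕ, ∑ c', (if c' = c then 0 else x) = (Fintype.card C - 1) * x := by
      simpa only [eq_comm] using h₁
    rw [h₁, h₂]
    obtain ⟨y, hy⟩ := Nat.exists_eq_add_of_le h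
    simp [hy]
    ring

end baseWeight

lemma MvPolynomial.IsHomogeneous.eval_mul {σ : Type*} [Fintype σ] {I : MvPolynomial σ ℂ} {d : ℕ}
    (hI : I.IsHomogeneous d) (z : ℂ) (a : σ → ℂ) :
    eval (fun i => z * a i) I = z ^ d * eval a I := by
  rw [eval_eq', eval_eq', Finset.mul_sum]
  refine Finset.sum_congr rfl fun e he => ?_
  have hd : ∑ i, e i = d := by
    have := hI (mem_support_iff.1 he)
    rw [Finsupp.weight_apply, Finsupp.sum_fintype _ _ (by simp)] at this
    simpa using this
  simp only [mul_pow, Finset.prod_mul_distrib, Finset.prod_pow_eq_pow_sum, hd]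
  ring

instance (t : ℕ) [NeZero t] : Fintype (rootsOfUnity t ℂ) := Fintype.ofFinite _

lemma card_rootsOfUnity_complex (t : ℕ) [NeZero t] : Fintype.card (rootsOfUnity t ℂ) = t := by
  rw [← Nat.card_eq_fintype_card, Complex.card_rootsOfUnity]

/-- The indices of the linear factors of the forms considered below: `j` factors `y`,
`r` factors `x`, and `m` cosets of the `t`-th roots of unity. -/
abbrev FactorIndex (j r m t : ℕ) : Type := (Fin j ⊕ Fin r) ⊕ (Fin m × rootsOfUnity t ℂ)

section configuration

variable {j r m t : ℕ} {R S : Type*} [CommRing R] [CommRing S]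

/-- The `x`-coefficients of the linear factors of
`y ^ j * x ^ r * ∏ s, ∏ η, (b * x - b * η * c s * y)`. -/
def factorX (b : R) : FactorIndex j r m t → R :=
  Sum.elim (Sum.elim 0 1) fun _ => b

/-- The `y`-coefficients of the linear factors of
`y ^ j * x ^ r * ∏ s, ∏ η, (b * x - b * η * c s * y)`. -/
def factorY [Algebra ℂ R] (b : R) (c : Fin m → R) : FactorIndex j r m t → R :=
  Sum.elim (Sum.elim 1 0) fun x => -b * algebraMap ℂ R (x.2 : ℂˣ) * c x.1

lemma map_factorX (φ : R →+* S) (b : R) (k : FactorIndex j r m t) :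
    φ (factorX b k) = factorX (φ b) k := by
  rcases k with (k | k) | k <;> simp [factorX]

lemma map_factorY [Algebra ℂ R] [Algebra ℂ S] (φ : R →ₐ[ℂ] S) (b : R) (c : Fin m → R)
    (k : FactorIndex j r m t) :
    φ (factorY b c k) = factorY (φ b) (fun s => φ (c s)) k := by
  rcases k with (k | k) | k <;> simp [factorY]

lemma card_factorIndex [NeZero t] : Fintype.card (FactorIndex j r m t) = j + r + m * t := by
  simp [card_rootsOfUnity_complex]

/-- The permutation of the linear factors induced by multiplication with a root of unity. -/
def factorRotate (η : rootsOfUnity t ℂ) : Equiv.Perm (FactorIndex j r m t) :=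
  Equiv.sumCongr (Equiv.refl _) (Equiv.prodCongr (Equiv.refl _) (Equiv.mulRight η))

/-- A homogeneous invariant of degree not divisible by `2 * t` vanishes on the forms
`y ^ j * x ^ r * ∏ s, ∏ η, (b * x - b * η * c s * y)`. -/
lemma eval_prodCoeff_factor_eq_zero [NeZero t] {n : ℕ}
    (hn : n = Fintype.card (FactorIndex j r m t)) (hodd : Odd n)
    (hcop : Int.gcd ((n : ℤ) - 2 * (j : ℤ)) (t : ℤ) = 1) (b : ℂ) (c : Fin m → ℂ)
    {I : MvPolynomial (Fin (n + 1)) ℂ} (hI : I ∈ invariantRing n) {d : ℕ}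
    (hd : I.IsHomogeneous d) (hdvd : ¬ 2 * t ∣ d) :
    eval (fun i : Fin (n + 1) =>
      prodCoeff (factorX (j := j) (r := r) (t := t) b) (factorY b c) (i : ℕ)) I = 0 := by
  have ht0 : t ≠ 0 := NeZero.ne t
  obtain ⟨ω, hω⟩ : ∃ ω : ℂ, IsPrimitiveRoot ω (2 * t) :=
    ⟨_, Complex.isPrimitiveRoot_exp (2 * t) (by positivity)⟩
  have hω0 : ω ≠ 0 := hω.ne_zero (by positivity)
  have hωt : (ω ^ 2) ^ t = 1 := by rw [← pow_mul, hω.pow_eq_one]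
  set η : rootsOfUnity t ℂ := rootsOfUnity.mkOfPowEq (ω ^ 2) hωt with hη
  have hη2 : ((η : ℂˣ) : ℂ) = ω ^ 2 := rootsOfUnity.val_mkOfPowEq_coe _ _
  let g : Matrix.SpecialLinearGroup (Fin 2) ℂ := ⟨!![ω, 0; 0, ω⁻¹], by simp [hω0]⟩
  let s : FactorIndex j r m t → ℂ := Sum.elim (Sum.elim (fun _ => ω⁻¹) fun _ => ω) fun _ => ω
  let e : Equiv.Perm (FactorIndex j r m t) := factorRotate η⁻¹
  set u : FactorIndex j r m t → ℂ := factorX b with hu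
  set v : FactorIndex j r m t → ℂ := factorY b c with hv
  have hgu : (fun k => u k * g.1 0 0 + v k * g.1 1 0) = s * (u ∘ e) := by
    funext k
    rcases k with (k | k) | k <;> simp [g, s, e, hu, hv, factorX, factorY, factorRotate, mul_comm]
  have hgv : (fun k => u k * g.1 0 1 + v k * g.1 1 1) = s * (v ∘ e) := by
    funext k
    rcases k with (k | k) | k
    · simp [g, s, e, hu, hv, factorX, factorY, factorRotate]
    · simp [g, s, e, hu, hv, factorX, factorY, factorRotate]
    · simp [g, s, e, hu, hv, factorX, factorY, factorRotate, hη2]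
      field_simp
  have hact := sl2Act_prodCoeff g u v
  rw [hgu, hgv] at hact
  simp only [prodCoeff_smul, prodCoeff_comp_equiv] at hact
  subst hn
  have hinv := hI g (fun i => prodCoeff u v (i : ℕ))
  rw [hact, hd.eval_mul] at hinv
  by_contra hne
  have hone : (∏ k, s k) ^ d = 1 := by
    simpa [hne] using hinv
  have hprod : ∏ k, s k = ω ^ (((Fintype.card (FactorIndex j r m t) : ℕ) : ℤ) - 2 * (j : ℤ)) := by
    have h : (((Fintype.card (FactorIndex j r m t) : ℕ) : ℤ) - 2 * (j : ℤ)) =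
        -(j : ℤ) + ((r : ℕ) : ℤ) + ((m * t : ℕ) : ℤ) := by
      rw [card_factorIndex]
      push_cast
      ring
    rw [h, zpow_add₀ hω0, zpow_add₀ hω0, zpow_natCast, zpow_natCast, zpow_neg, zpow_natCast]
    simp [s, Fintype.prod_sum_type, card_rootsOfUnity_complex]
  rw [hprod, ← zpow_natCast, ← zpow_mul, hω.zpow_eq_one_iff_dvd] at hone
  have hcop2 : IsCoprime (((2 * t : ℕ) : ℤ))
      (((Fintype.card (FactorIndex j r m t) : ℕ) : ℤ) - 2 * (j : ℤ)) := by
    push_cast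
    refine IsCoprime.mul_left ?_ (Int.isCoprime_iff_gcd_eq_one.2 hcop).symm
    obtain ⟨k, hk⟩ := hodd
    exact ⟨(j : ℤ) - k, 1, by rw [hk]; push_cast; ring⟩
  exact hdvd (Int.natCast_dvd_natCast.1 (hcop2.dvd_of_dvd_mul_left hone))

end configuration

lemma isAlgebraic_of_mul_sub_one_sq_eq {A R : Type*} [CommRing A] [CommRing R] [IsDomain A]
    [IsDomain R] [Algebra A R] {x y c : R} (hx : IsAlgebraic A x) (hy : IsAlgebraic A y)
    (hx0 : x ≠ 0) (h : x * (c - 1) ^ 2 = y * c) : IsAlgebraic A c := by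
  let L := Subalgebra.algebraicClosure A R
  let x' : L := ⟨x, hx⟩
  let y' : L := ⟨y, hy⟩
  have hL : IsAlgebraic L c := by
    refine ⟨Polynomial.C x' * (Polynomial.X - 1) ^ 2 - Polynomial.C y' * Polynomial.X, ?_, ?_⟩
    · intro h0
      have h1 := congrArg (Polynomial.eval 0) h0
      simp at h1
      exact hx0 (congrArg Subtype.val h1)
    · have hx' : algebraMap L R x' = x := rfl
      have hy' : algebraMap L R y' = y := rfl
      simp [hx', hy', h]
  exact hL.restrictScalars A

section algebraic

variable {j r m t : ℕ} {R : Type*} [CommRing R] [Algebra ℂ R]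

lemma bracket_factor_inr_inr (b : R) (c : Fin m → R) (k l : Fin m × rootsOfUnity t ℂ) :
    factorX (j := j) (r := r) b (.inr k) * factorY (j := j) (r := r) b c (.inr l) -
      factorX (j := j) (r := r) b (.inr l) * factorY (j := j) (r := r) b c (.inr k) =
    b ^ 2 * (algebraMap ℂ R (k.2 : ℂˣ) * c k.1 - algebraMap ℂ R (l.2 : ℂˣ) * c l.1) := by
  simp only [factorX, factorY, Sum.elim_inr]
  ring

lemma bracketProd_factor_eq_pow_mul [NeZero t]
    {w : FactorIndex j r m t × FactorIndex j r m t → ℕ} {D : ℕ}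
    (hw : IsRegularWeight w D) (b : R) (c : Fin m → R) :
    bracketProd (factorX b) (factorY b c) w =
      b ^ (m * t * D) * bracketProd (factorX 1) (factorY 1 c) w := by
  let s : FactorIndex j r m t → R := Sum.elim 1 fun _ => b
  have hX : factorX b = s * factorX 1 := by
    funext k
    rcases k with (k | k) | k <;> simp [factorX, s]
  have hY : factorY b c = s * factorY 1 c := by
    funext k
    rcases k with (k | k) | k <;> simp [factorY, s, mul_assoc]
  rw [hX, hY, hw.bracketProd_mul]
  congr 1
  simp [s, Fintype.prod_sum_type, card_rootsOfUnity_complex, pow_mul]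

lemma bracketProd_factor_baseWeight_ne_zero [NeZero t] :
    bracketProd (factorX (j := j) (r := r) (m := m) (t := t) (1 : ℂ))
      (factorY 1 fun s => ((s : ℕ) : ℂ) + 1) (baseWeight _ _) ≠ 0 := by
  refine Finset.prod_ne_zero_iff.2 fun e _ => ?_
  obtain ⟨k, l⟩ := e
  have hne : ∀ s : Fin m, ((s : ℕ) : ℂ) + 1 ≠ 0 := fun s => Nat.cast_add_one_ne_zero _
  rcases l with l | l
  · rcases k with k | k <;> simp [baseWeight]
  · rcases k with (k | k) | k
    · exact pow_ne_zero _ (by simp [factorX, factorY])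
    · exact pow_ne_zero _ (by simp [factorX, factorY, hne])
    · by_cases hkl : k = l
      · simp [baseWeight, hkl]
      refine pow_ne_zero _ ?_
      simp only [bracket_factor_inr_inr]
      intro h
      have h1 : ((k.2 : ℂˣ) : ℂ) * (((k.1 : ℕ) : ℂ) + 1) = ((l.2 : ℂˣ) : ℂ) * (((l.1 : ℕ) : ℂ) + 1) := by
        simpa [sub_eq_zero] using h
      have hnorm : ∀ s : Fin m, ‖((s : ℕ) : ℂ) + 1‖ = (s : ℕ) + 1 := fun s => by
        exact_mod_cast Complex.norm_natCast ((s : ℕ) + 1)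
      have h2 := congrArg norm h1
      rw [norm_mul, norm_mul, Complex.norm_eq_one_of_mem_rootsOfUnity k.2.2,
        Complex.norm_eq_one_of_mem_rootsOfUnity l.2.2, hnorm, hnorm] at h2
      have h3 : k.1 = l.1 := Fin.ext (by exact_mod_cast (by linarith : ((k.1 : ℕ) : ℝ) = (l.1 : ℕ)))
      rw [h3] at h1
      exact hkl (Prod.ext h3 (Subtype.ext (Units.ext (mul_right_cancel₀ (hne _) h1))))

end algebraic

section generic

variable {j r m t : ℕ} [NeZero m] [NeZero t]

/-- The parameters of the generic form with factors indexed by `FactorIndex j r m t`, where the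
parameter of the first coset is normalized to `1`. -/
def genericParam (s : Fin m) : MvPolynomial (Fin m) ℂ :=
  if s = 0 then 1 else X s

/-- The bracket products of the generic form with factors indexed by `FactorIndex j r m t`. -/
def genericBracket (w : FactorIndex j r m t × FactorIndex j r m t → ℕ) :
    MvPolynomial (Fin m) ℂ :=
  bracketProd (factorX (X 0)) (factorY (X 0) genericParam) w

lemma bracketProd_genericParam_baseWeight_ne_zero :
    bracketProd (factorX 1) (factorY 1 genericParam)
      (baseWeight (Fin j ⊕ Fin r) (Fin m × rootsOfUnity t ℂ)) ≠ (0 : MvPolynomial (Fin m) ℂ) := by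
  intro h
  let φ : MvPolynomial (Fin m) ℂ →ₐ[ℂ] ℂ := aeval fun s : Fin m => ((s : ℕ) : ℂ) + 1
  have hφ : ∀ s : Fin m, φ (genericParam s) = ((s : ℕ) : ℂ) + 1 := by
    intro s
    by_cases hs : s = 0 <;> simp [genericParam, φ, hs]
  have h1 := congrArg φ.toRingHom h
  rw [map_bracketProd, map_zero] at h1
  refine bracketProd_factor_baseWeight_ne_zero (j := j) (r := r) (m := m) (t := t) ?_
  rw [← h1]
  congr 1
  · funext k
    rw [map_factorX, map_one]
  · funext k
    simp only [← hφ]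
    exact (map_one φ ▸ map_factorY φ 1 genericParam k).symm

lemma genericBracket_baseWeight_ne_zero (h : j + r ≤ m * t) :
    genericBracket (baseWeight (Fin j ⊕ Fin r) (Fin m × rootsOfUnity t ℂ)) ≠ 0 := by
  have hreg := isRegularWeight_baseWeight (Z := Fin j ⊕ Fin r) (C := Fin m × rootsOfUnity t ℂ)
    (by simpa [card_rootsOfUnity_complex] using h)
  rw [genericBracket, bracketProd_factor_eq_pow_mul hreg]
  exact mul_ne_zero (pow_ne_zero _ (X_ne_zero _)) bracketProd_genericParam_baseWeight_ne_zero

variable {G : Subalgebra ℂ (MvPolynomial (Fin m) ℂ)}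

lemma isAlgebraic_genericParam (ht : 1 < t) (hlt : j + r < m * t)
    (hG : ∀ (w : FactorIndex j r m t × FactorIndex j r m t → ℕ) (D : ℕ), IsRegularWeight w D →
      IsAlgebraic G (genericBracket w)) (s : Fin m) : IsAlgebraic G (genericParam s) := by
  by_cases hs : s = 0
  · simpa [genericParam, hs] using isAlgebraic_one
  have hcard : Fintype.card (Fin j ⊕ Fin r) < Fintype.card (Fin m × rootsOfUnity t ℂ) := by
    simpa [card_rootsOfUnity_complex] using hlt
  obtain ⟨ζ, hζ⟩ : ∃ ζ : rootsOfUnity t ℂ, ζ ≠ 1 :=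
    Fintype.exists_ne_of_one_lt_card (by rwa [card_rootsOfUnity_complex]) 1
  have hζ1 : ((ζ : ℂˣ) : ℂ) ≠ 1 := fun h => hζ (Subtype.ext (Units.ext h))
  set w := baseWeight (Fin j ⊕ Fin r) (Fin m × rootsOfUnity t ℂ) with hw
  have hwreg := isRegularWeight_baseWeight hcard.le
  have hw0 : ∀ k l : Fin m × rootsOfUnity t ℂ, k ≠ l → w (.inr k, .inr l) ≠ 0 := by
    intro k l hkl
    simp only [hw, baseWeight, hkl, if_false]
    omega
  obtain ⟨w₀, hw₀⟩ := exists_eq_add_single_add_single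
    (e := (Sum.inr (0, 1), Sum.inr (0, ζ))) (f := (Sum.inr (s, 1), Sum.inr (s, ζ)))
    (w := w) (by simp [Ne.symm hs]) (hw0 _ _ (by simp [hζ.symm])) (hw0 _ _ (by simp [hζ.symm]))
  have hne := genericBracket_baseWeight_ne_zero (j := j) (r := r) (m := m) (t := t) hlt.le
  have halg := hG _ _ hwreg
  rw [← hw, hw₀] at hwreg hne halg
  have halg' := hG _ _ hwreg.swap
  set c : MvPolynomial (Fin m) ℂ := genericParam s with hc
  have hc0 : genericParam (0 : Fin m) = 1 := by simp [genericParam]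
  set z : MvPolynomial (Fin m) ℂ := algebraMap ℂ _ ((ζ : ℂˣ) : ℂ) with hz
  have hzalg : IsAlgebraic G z :=
    isAlgebraic_algebraMap (⟨z, Subalgebra.algebraMap_mem G _⟩ : G)
  refine isAlgebraic_of_mul_sub_one_sq_eq (halg.mul hzalg)
    (halg'.mul ((hzalg.sub isAlgebraic_one).pow 2)) (mul_ne_zero hne ?_) ?_
  · simp [hz]
  · simp only [genericBracket, bracketProd_add, bracketProd_single, bracket_factor_inr_inr, hc0,
      ← hc, ← hz]
    simp only [OneMemClass.coe_one, Units.val_one, map_one]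
    ring

lemma isAlgebraic_of_forall_isAlgebraic_genericBracket (ht : 1 < t) (hlt : j + r < m * t)
    (hG : ∀ (w : FactorIndex j r m t × FactorIndex j r m t → ℕ) (D : ℕ), IsRegularWeight w D →
      IsAlgebraic G (genericBracket w)) : Algebra.IsAlgebraic G (MvPolynomial (Fin m) ℂ) := by
  let L := Subalgebra.algebraicClosure G (MvPolynomial (Fin m) ℂ)
  have hconst : ∀ z : ℂ, C z ∈ L := fun z =>
    isAlgebraic_algebraMap (⟨C z, Subalgebra.algebraMap_mem G z⟩ : G)
  have hparam : ∀ s : Fin m, genericParam s ∈ L := isAlgebraic_genericParam ht hlt hG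
  have hX0 : X 0 ∈ L := by
    have hcard : Fintype.card (Fin j ⊕ Fin r) < Fintype.card (Fin m × rootsOfUnity t ℂ) := by
      simpa [card_rootsOfUnity_complex] using hlt
    have hreg := isRegularWeight_baseWeight hcard.le
    have halg := hG _ _ hreg
    rw [genericBracket, bracketProd_factor_eq_pow_mul hreg, mul_comm] at halg
    refine IsAlgebraic.of_pow ?_ (IsAlgebraic.of_mul (mem_nonZeroDivisors_of_ne_zero
      (bracketProd_genericParam_baseWeight_ne_zero (j := j) (r := r))) ?_ halg)
    · have h2 : 1 < m * t := lt_of_lt_of_le ht (Nat.le_mul_of_pos_left t (NeZero.pos m))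
      have h3 : Fintype.card (Fin m × rootsOfUnity t ℂ) = m * t := by
        simp [card_rootsOfUnity_complex]
      rw [h3]
      have : 0 < m * t - 1 := by omega
      positivity
    · have hX : ∀ k : FactorIndex j r m t,
          (factorX 1 k : MvPolynomial (Fin m) ℂ) ∈ L := by
        rintro ((k | k) | k)
        · exact L.zero_mem
        · exact L.one_mem
        · exact L.one_mem
      have hY : ∀ k : FactorIndex j r m t, factorY 1 genericParam k ∈ L := by
        rintro ((k | k) | k)
        · exact L.one_mem
        · exact L.zero_mem
        · exact L.mul_mem (L.mul_mem (L.neg_mem L.one_mem) (hconst _)) (hparam _)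
      exact L.prod_mem fun e _ => L.pow_mem
        (L.sub_mem (L.mul_mem (hX _) (hY _)) (L.mul_mem (hX _) (hY _))) _
  have hX : ∀ s : Fin m, X s ∈ L := by
    intro s
    by_cases hs : s = 0
    · rwa [hs]
    · simpa [genericParam, hs] using hparam s
  refine ⟨fun q => ?_⟩
  change q ∈ L
  induction q using MvPolynomial.induction_on with
  | C z => exact hconst z
  | add p q hp hq => exact L.add_mem hp hq
  | mul_X p s hp => exact L.mul_mem hp (hX s)

/-- A set of algebra generators whose algebraic closure contains all bracket products of the
generic form has at least `m` elements. -/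
lemma le_card_of_forall_isAlgebraic_genericBracket {κ : Type} (f : κ → MvPolynomial (Fin m) ℂ)
    (K : Finset κ) (ht : 1 < t) (hlt : j + r < m * t)
    (hG : ∀ (w : FactorIndex j r m t × FactorIndex j r m t → ℕ) (D : ℕ), IsRegularWeight w D →
      IsAlgebraic (Algebra.adjoin ℂ (f '' (K : Set κ))) (genericBracket w)) : m ≤ K.card := by
  have := isAlgebraic_of_forall_isAlgebraic_genericBracket ht hlt hG
  have h1 := Algebra.IsAlgebraic.trdeg_le_cardinalMk ℂ (f '' (K : Set κ))
  rw [MvPolynomial.trdeg_of_isDomain] at h1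
  have h2 := h1.trans Cardinal.mk_image_le
  simpa using h2

end generic

lemma aeval_prodCoeff_factor_eq_zero {j r m t : ℕ} [NeZero t] {n : ℕ}
    (hn : n = Fintype.card (FactorIndex j r m t)) (hodd : Odd n)
    (hcop : Int.gcd ((n : ℤ) - 2 * (j : ℤ)) (t : ℤ) = 1) {σ : Type*} (b : MvPolynomial σ ℂ)
    (c : Fin m → MvPolynomial σ ℂ) {I : MvPolynomial (Fin (n + 1)) ℂ} (hI : I ∈ invariantRing n)
    {d : ℕ} (hd : I.IsHomogeneous d) (hdvd : ¬ 2 * t ∣ d) :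
    aeval (fun i : Fin (n + 1) =>
      prodCoeff (factorX (j := j) (r := r) (t := t) b) (factorY b c) (i : ℕ)) I = 0 := by
  refine MvPolynomial.funext fun x => ?_
  rw [map_zero, ← eval_prodCoeff_factor_eq_zero hn hodd hcop (eval x b) (fun s => eval x (c s))
    hI hd hdvd]
  simp only [eval_eq_aeval, comp_aeval_apply]
  congr 2
  funext i
  rw [← AlgHom.coe_toRingHom, map_prodCoeff]
  congr 1
  · funext k
    exact map_factorX (aeval x : MvPolynomial σ ℂ →ₐ[ℂ] ℂ).toRingHom _ _
  · funext k
    exact map_factorY (aeval x) _ _ _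

/-- The divisibility theorem for forms of degree `j + r + m * t`. -/
lemma IsHSOP.le_card_filter_dvd {n j r m t : ℕ} [NeZero m] (hn : n = j + r + m * t)
    (hodd : Odd n) (ht : 1 < t) (hlt : j + r < m * t)
    (hcop : Int.gcd ((n : ℤ) - 2 * (j : ℤ)) (t : ℤ) = 1)
    {d : Fin (n - 2) → ℕ} {p : Fin (n - 2) → invariantRing n} (hp : IsHSOP n d p) :
    m ≤ (Finset.univ.filter fun k => 2 * t ∣ d k).card := by
  have : NeZero t := ⟨by omega⟩
  have hn' : n = Fintype.card (FactorIndex j r m t) := by rw [hn, card_factorIndex]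
  subst hn'
  have : Nonempty (FactorIndex j r m t) := ⟨.inr (0, 1)⟩
  refine le_card_of_forall_isAlgebraic_genericBracket (j := j) (r := r) (t := t)
    (fun k => aeval (fun i : Fin (Fintype.card (FactorIndex j r m t) + 1) =>
      prodCoeff (factorX (j := j) (r := r) (t := t) (X 0)) (factorY (X 0) genericParam) (i : ℕ))
      (p k).1) _ ht hlt fun w D hw => ?_
  have := hp.isIntegral_aeval (factorX (X (0 : Fin m))) (factorY (X 0) genericParam)
    (Finset.univ.filter fun k => 2 * t ∣ d k) (fun k hk => ?_) hw.isMultihomogeneous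
    (isSLInvariant_bracketMonomial w)
  · rw [aeval_bracketMonomial] at this
    exact this.isAlgebraic
  · exact aeval_prodCoeff_factor_eq_zero rfl hodd hcop _ _ (p k).2 (hp.2.1 k) (by simpa using hk)

lemma add_mod_lt_div_mul {n j t : ℕ} (hodd : Odd n) (ht : 1 < t) (hjn : j ≤ n)
    (hcop : Int.gcd ((n : ℤ) - 2 * (j : ℤ)) (t : ℤ) = 1)
    (hmin : ∀ j' : ℕ, j' < j → Int.gcd ((n : ℤ) - 2 * (j' : ℤ)) (t : ℤ) ≠ 1)
    (hpos : 0 < (n - j) / t) : j + (n - j) % t < (n - j) / t * t := by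
  have hdiv := Nat.div_add_mod' (n - j) t
  have hmod := Nat.mod_lt (n - j) (by omega : 0 < t)
  set m := (n - j) / t
  set r := (n - j) % t
  have hjt : j < t := by
    by_contra h
    refine hmin (j - t) (by omega) ?_
    rw [← hcop, Nat.cast_sub (by omega)]
    have : (n : ℤ) - 2 * ((j : ℤ) - t) = (n - 2 * j) + 2 * t := by ring
    rw [this, Int.gcd_add_mul_right_left]
  by_contra hle
  have hm : m = 1 := by
    by_contra hm
    have : 2 * t ≤ m * t := Nat.mul_le_mul_right t (by omega)
    omega
  rw [hm] at hle hdiv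
  obtain ⟨k, hk⟩ := hodd
  refine hmin (k - t) (by omega) ?_
  rw [Nat.cast_sub (by omega)]
  have : (n : ℤ) - 2 * ((k : ℤ) - t) = 1 + 2 * t := by
    rw [hk]
    push_cast
    ring
  rw [this, Int.gcd_add_mul_right_left]
  simp

theorem stmt_2 (n : ℕ) (hn : 3 ≤ n) (hodd : Odd n) (t : ℕ) (ht : 1 < t)
    (j : ℕ) (hjn : j ≤ n) (hcop : Int.gcd ((n : ℤ) - 2 * (j : ℤ)) (t : ℤ) = 1)
    (hmin : ∀ j' : ℕ, j' < j → Int.gcd ((n : ℤ) - 2 * (j' : ℤ)) (t : ℤ) ≠ 1)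
    (d : Fin (n-2) → ℕ) (p : Fin (n-2) → invariantRing n) (hp : IsHSOP n d p) :
    (n - j) / t ≤ (Finset.univ.filter fun k => 2 * t ∣ d k).card := by
  rcases Nat.eq_zero_or_pos ((n - j) / t) with h0 | hpos
  · omega
  have : NeZero ((n - j) / t) := ⟨hpos.ne'⟩
  have hdiv := Nat.div_add_mod' (n - j) t
  exact hp.le_card_filter_dvd (r := (n - j) % t) (by omega) hodd ht
    (add_mod_lt_div_mul hodd ht hjn hcop hmin hpos) hcop
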